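/- Every connected cubic graph on n = 4t vertices that is not isomorphic to K_4 contains a spanning subgraph with exactly t vertices of each of the degrees 0, 1, 2, 3. -/

import Mathlib

open SimpleGraph

/-- The degree of `v` in `H`, as the cardinality of its neighbor set. -/
noncomputable def nDeg {V : Type*} (H : SimpleGraph V) (v : V) : ℕ :=
  (H.neighborSet v).ncard

/-- The number of vertices of degree `k` in `H`. -/
noncomputable def degCount {V : Type*} (H : SimpleGraph V) (k : ℕ) : ℕ :=
  {v | nDeg H v = k}.ncard

def K4 : SimpleGraph (Fin 4) := completeGraph (Fin 4)

def K33 : SimpleGraph (Fin 3 ⊕ Fin 3) := completeBipartiteGraph (Fin 3) (Fin 3)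

/-- The disjoint union of `m` copies of `K₄`. -/
def unionK4 (m : ℕ) : SimpleGraph (Fin m × Fin 4) :=
  SimpleGraph.fromRel (fun p q => p.1 = q.1)

section SpanningSubgraphs

variable {V : Type*} {G H : SimpleGraph V}

open scoped Classical in
theorem nDeg_edge {a b : V} (hab : a ≠ b) (x : V) :
    nDeg (edge a b) x = if x = a ∨ x = b then 1 else 0 := by
  by_cases ha : x = a
  · subst ha
    have : (edge x b).neighborSet x = {b} := by
      ext y
      simp only [mem_neighborSet, edge_adj, Set.mem_singleton_iff]
      grind
    simp [nDeg, this]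
  by_cases hb : x = b
  · subst hb
    have : (edge a x).neighborSet x = {a} := by
      ext y
      simp only [mem_neighborSet, edge_adj, Set.mem_singleton_iff]
      grind
    simp [nDeg, this]
  · have : (edge a b).neighborSet x = ∅ := by
      ext y
      simp only [mem_neighborSet, edge_adj, Set.mem_empty_iff_false]
      grind
    simp [nDeg, this, ha, hb]

/-- `H` uses half of the edges of a cubic graph `G` on `4 * t` vertices and has at least `t`
vertices of each of the degrees `0` and `3`. -/
structure IsAdmissible (G : SimpleGraph V) (t : ℕ) (H : SimpleGraph V) : Prop where
  le : H ≤ G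
  zero : t ≤ degCount H 0
  three : t ≤ degCount H 3
  half : degCount H 1 + 2 * degCount H 2 + 3 * degCount H 3 = 6 * t

structure IsOptimal (G : SimpleGraph V) (t : ℕ) (H : SimpleGraph V) : Prop
    extends IsAdmissible G t H where
  min : ∀ K, IsAdmissible G t K → degCount H 0 + degCount H 3 ≤ degCount K 0 + degCount K 3

theorem IsAdmissible.exists_isOptimal {t : ℕ} (h : IsAdmissible G t H) :
    ∃ K, IsOptimal G t K := by
  obtain ⟨K, hK, hmin⟩ := exists_minimalFor_of_wellFoundedLT (IsAdmissible G t)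
    (fun K => degCount K 0 + degCount K 3) ⟨H, h⟩
  exact ⟨K, hK, fun L hL => (le_total _ _).elim id (hmin hL)⟩

theorem IsOptimal.false_of_exchange {t : ℕ} (hopt : IsOptimal G t H) {L L' : List ℕ}
    (hex : ∃ H' ≤ G, ∀ k, degCount H' k + L.count k = degCount H k + L'.count k)
    (hhalf : L.count 1 + 2 * L.count 2 + 3 * L.count 3 =
      L'.count 1 + 2 * L'.count 2 + 3 * L'.count 3)
    (hlt : L'.count 0 + L'.count 3 < L.count 0 + L.count 3)
    (h0 : t + L.count 0 ≤ degCount H 0 + L'.count 0)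
    (h3 : t + L.count 3 ≤ degCount H 3 + L'.count 3) : False := by
  obtain ⟨H', hle, hk⟩ := hex
  have hs := hopt.half
  have h0' := hk 0
  have h1' := hk 1
  have h2' := hk 2
  have h3' := hk 3
  have := hopt.min H' ⟨hle, by omega, by omega, by omega⟩
  omega

theorem exists_adj_mem_notMem (hG : G.Connected) (S : Set V) {a b : V} (ha : a ∈ S) (hb : b ∉ S) :
    ∃ x ∈ S, ∃ y ∉ S, G.Adj x y := by
  obtain ⟨p⟩ := hG.preconnected a b
  obtain ⟨d, -, h1, h2⟩ := p.exists_boundary_dart S ha hb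
  exact ⟨d.fst, h1, d.snd, h2, d.adj⟩

theorem exists_ne_of_one_lt_degCount {k : ℕ} (h : 1 < degCount H k) (v : V) :
    ∃ w, w ≠ v ∧ nDeg H w = k := by
  obtain ⟨w, hw, hne⟩ := Set.exists_ne_of_one_lt_ncard h v
  exact ⟨w, hne, hw⟩

theorem exists_two_adj {v : V} (h : nDeg H v = 2) : ∃ x y, x ≠ y ∧ H.Adj v x ∧ H.Adj v y := by
  obtain ⟨x, y, hne, hxy⟩ := Set.ncard_eq_two.1 h
  refine ⟨x, y, hne, ?_, ?_⟩ <;> rw [← mem_neighborSet, hxy] <;> simp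

variable [Fintype V]

open scoped Classical in
theorem nDeg_eq_degree (H : SimpleGraph V) (v : V) : nDeg H v = H.degree v := by
  rw [nDeg, Set.ncard_eq_toFinset_card', ← card_neighborFinset_eq_degree]
  rfl

theorem nDeg_mono {H K : SimpleGraph V} (h : H ≤ K) (v : V) : nDeg H v ≤ nDeg K v :=
  Set.ncard_le_ncard (fun _ hx => h hx) (Set.toFinite _)

theorem nDeg_sup {A B : SimpleGraph V} (h : Disjoint A B) (v : V) :
    nDeg (A ⊔ B) v = nDeg A v + nDeg B v := by
  have hs : (A ⊔ B).neighborSet v = A.neighborSet v ∪ B.neighborSet v := rfl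
  rw [nDeg, hs, Set.ncard_union_eq _ (Set.toFinite _) (Set.toFinite _)]
  · rfl
  · rw [Set.disjoint_left]
    intro x hx hy
    have : (A ⊓ B).Adj v x := ⟨hx, hy⟩
    rw [h.eq_bot] at this
    exact this

theorem nDeg_sdiff {H K : SimpleGraph V} (h : H ≤ K) (v : V) :
    nDeg (K \ H) v + nDeg H v = nDeg K v := by
  rw [← nDeg_sup disjoint_sdiff_self_left, sdiff_sup_cancel h]

open scoped Classical in
theorem nDeg_edge_sup_edge {a b c d : V} (hab : a ≠ b) (hcd : c ≠ d) (h : s(a, b) ≠ s(c, d))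
    (x : V) : nDeg (edge a b ⊔ edge c d) x =
      (if x = a ∨ x = b then 1 else 0) + (if x = c ∨ x = d then 1 else 0) := by
  rw [nDeg_sup, nDeg_edge hab, nDeg_edge hcd]
  rw [disjoint_edge, adj_edge]
  exact fun hh => h hh.1

open scoped Classical in
theorem degCount_eq_sum (H : SimpleGraph V) (k : ℕ) :
    degCount H k = ∑ v, if nDeg H v = k then 1 else 0 := by
  rw [degCount, Set.ncard_eq_toFinset_card']
  simp

theorem degCount_of_eq_off {H K : SimpleGraph V} (T : List (V × ℕ × ℕ))
    (hT : (T.map Prod.fst).Nodup)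
    (hp : ∀ p ∈ T, nDeg H p.1 = p.2.1 ∧ nDeg K p.1 = p.2.2)
    (hoff : ∀ x, x ∉ T.map Prod.fst → nDeg H x = nDeg K x) (k : ℕ) :
    degCount K k + (T.map fun p => p.2.1).count k =
      degCount H k + (T.map fun p => p.2.2).count k := by
  classical
  have key : ∀ (f : SimpleGraph V) (g : V × ℕ × ℕ → ℕ), (∀ p ∈ T, nDeg f p.1 = g p) →
      degCount f k = T.countP (fun p => g p = k) +
        ∑ v ∈ Finset.univ \ (T.map Prod.fst).toFinset, if nDeg f v = k then 1 else 0 := by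
    intro f g hfg
    have hsum : ∀ L : List (V × ℕ × ℕ),
        (L.map fun p => if g p = k then 1 else 0).sum = L.countP (fun p => g p = k) := by
      intro L
      induction L with
      | nil => rfl
      | cons p L ih =>
        simp only [List.map_cons, List.sum_cons, ih, List.countP_cons, decide_eq_true_eq]
        omega
    rw [degCount_eq_sum, ← Finset.sum_sdiff (Finset.subset_univ (T.map Prod.fst).toFinset),
      add_comm, List.sum_toFinset _ hT, List.map_map, ← hsum]
    congr 2
    refine List.map_congr_left fun p hp => ?_
    simp [hfg p hp]
  have hrest : ∑ v ∈ Finset.univ \ (T.map Prod.fst).toFinset, (if nDeg H v = k then 1 else 0) =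
      ∑ v ∈ Finset.univ \ (T.map Prod.fst).toFinset, if nDeg K v = k then 1 else 0 :=
    Finset.sum_congr rfl fun x hx => by rw [hoff x (by simpa using hx)]
  rw [key H (fun p => p.2.1) fun p h => (hp p h).1, key K (fun p => p.2.2) fun p h => (hp p h).2,
    hrest, List.count_eq_countP, List.count_eq_countP, List.countP_map, List.countP_map]
  simp only [Function.comp_def, beq_eq_decide]
  omega

/-- Removing the edges of `R` from `H` and adding those of `A`, when only the vertices listed in `T`
change their degree; the entries of `T` record a vertex, its old degree and its new degree. -/
theorem exists_exchange (hH : H ≤ G) {R A : SimpleGraph V} (hR : R ≤ H) (hA : A ≤ G)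
    (hAH : Disjoint A H) (T : List (V × ℕ × ℕ)) (hT : (T.map Prod.fst).Nodup)
    (hp : ∀ p ∈ T, nDeg H p.1 = p.2.1 ∧ p.2.1 + nDeg A p.1 = p.2.2 + nDeg R p.1)
    (hoff : ∀ x, x ∉ T.map Prod.fst → nDeg R x = nDeg A x) :
    ∃ H' ≤ G, ∀ k, degCount H' k + (T.map fun p => p.2.1).count k =
      degCount H k + (T.map fun p => p.2.2).count k := by
  have hdeg : ∀ x, nDeg (H \ R ⊔ A) x + nDeg R x = nDeg H x + nDeg A x := by
    intro x
    rw [nDeg_sup (hAH.symm.mono_left sdiff_le), ← nDeg_sdiff hR]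
    omega
  refine ⟨H \ R ⊔ A, sup_le (sdiff_le.trans hH) hA, degCount_of_eq_off T hT ?_ ?_⟩
  · intro p h
    have := hp p h
    have := hdeg p.1
    omega
  · intro x hx
    have := hoff x hx
    have := hdeg x
    omega

theorem exists_edge_swap (hH : H ≤ G) {a b c d : V} (hab : H.Adj a b) (hcd : G.Adj c d)
    (hn : ¬ H.Adj c d) (hT : [a, b, c, d].Nodup) :
    ∃ H' ≤ G, ∀ k,
      degCount H' k + [nDeg H a, nDeg H b, nDeg H c, nDeg H d].count k =
        degCount H k + [nDeg H a - 1, nDeg H b - 1, nDeg H c + 1, nDeg H d + 1].count k := by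
  classical
  have hR : edge a b ≤ H := (edge_le_iff _).2 (.inr hab)
  have ha := nDeg_mono hR a
  have hb := nDeg_mono hR b
  simp only [List.nodup_cons, List.mem_cons, List.not_mem_nil, or_false, not_or, not_false_eq_true,
    List.nodup_nil, and_true] at hT
  refine exists_exchange hH hR ((edge_le_iff _).2 (Or.inr hcd)) ((disjoint_edge _).2 hn).symm
    [(a, nDeg H a, nDeg H a - 1), (b, nDeg H b, nDeg H b - 1), (c, nDeg H c, nDeg H c + 1),
      (d, nDeg H d, nDeg H d + 1)] ?_ ?_ ?_
  · simp
    grind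
  · simp only [nDeg_edge hab.ne, nDeg_edge hcd.ne] at *
    simp
    grind
  · simp only [nDeg_edge hab.ne, nDeg_edge hcd.ne]
    simp
    grind

theorem exists_edge_rotation (hH : H ≤ G) {a b c : V} (hab : H.Adj a b) (hbc : G.Adj b c)
    (hn : ¬ H.Adj b c) :
    ∃ H' ≤ G, ∀ k, degCount H' k + [nDeg H a, nDeg H c].count k =
      degCount H k + [nDeg H a - 1, nDeg H c + 1].count k := by
  classical
  have hR : edge a b ≤ H := (edge_le_iff _).2 (.inr hab)
  have ha := nDeg_mono hR a
  have hac : a ≠ c := by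
    rintro rfl
    exact hn hab.symm
  have := hab.ne
  have := hbc.ne
  refine exists_exchange hH hR ((edge_le_iff _).2 (Or.inr hbc)) ((disjoint_edge _).2 hn).symm
    [(a, nDeg H a, nDeg H a - 1), (c, nDeg H c, nDeg H c + 1)] ?_ ?_ ?_
  · simpa using hac
  · simp only [nDeg_edge hab.ne, nDeg_edge hbc.ne] at *
    simp
    grind
  · simp only [nDeg_edge hab.ne, nDeg_edge hbc.ne]
    simp
    grind

open scoped Classical in
theorem exists_edge_exchange_two (hH : H ≤ G) {a b a' b' c d c' d' : V} (hab : H.Adj a b)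
    (hab' : H.Adj a' b') (hR : s(a, b) ≠ s(a', b')) (hcd : G.Adj c d) (hn : ¬ H.Adj c d)
    (hcd' : G.Adj c' d') (hn' : ¬ H.Adj c' d') (hA : s(c, d) ≠ s(c', d'))
    (T : List (V × ℕ × ℕ)) (hT : (T.map Prod.fst).Nodup)
    (hp : ∀ p ∈ T, nDeg H p.1 = p.2.1 ∧
      p.2.1 + ((if p.1 = c ∨ p.1 = d then 1 else 0) + (if p.1 = c' ∨ p.1 = d' then 1 else 0)) =
        p.2.2 + ((if p.1 = a ∨ p.1 = b then 1 else 0) + (if p.1 = a' ∨ p.1 = b' then 1 else 0)))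
    (hoff : ∀ x, x ∉ T.map Prod.fst →
      (if x = a ∨ x = b then 1 else 0) + (if x = a' ∨ x = b' then 1 else 0) =
        (if x = c ∨ x = d then 1 else 0) + (if x = c' ∨ x = d' then 1 else 0)) :
    ∃ H' ≤ G, ∀ k, degCount H' k + (T.map fun p => p.2.1).count k =
      degCount H k + (T.map fun p => p.2.2).count k := by
  refine exists_exchange hH (R := edge a b ⊔ edge a' b') (A := edge c d ⊔ edge c' d')
    (sup_le ((edge_le_iff _).2 (.inr hab)) ((edge_le_iff _).2 (.inr hab')))
    (sup_le ((edge_le_iff _).2 (.inr hcd)) ((edge_le_iff _).2 (.inr hcd')))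
    (disjoint_sup_left.2 ⟨((disjoint_edge _).2 hn).symm, ((disjoint_edge _).2 hn').symm⟩)
    T hT ?_ ?_
  · simpa only [nDeg_edge_sup_edge hab.ne hab'.ne hR, nDeg_edge_sup_edge hcd.ne hcd'.ne hA] using hp
  · simpa only [nDeg_edge_sup_edge hab.ne hab'.ne hR, nDeg_edge_sup_edge hcd.ne hcd'.ne hA]
      using hoff

theorem sum_nDeg_eq (h : ∀ v, nDeg H v ≤ 3) :
    ∑ v, nDeg H v = degCount H 1 + 2 * degCount H 2 + 3 * degCount H 3 := by
  simp only [degCount_eq_sum, Finset.mul_sum, ← Finset.sum_add_distrib]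
  refine Finset.sum_congr rfl fun v _ => ?_
  have := h v
  interval_cases nDeg H v <;> rfl

theorem sum_degCount_eq (h : ∀ v, nDeg H v ≤ 3) :
    degCount H 0 + degCount H 1 + degCount H 2 + degCount H 3 = Fintype.card V := by
  rw [Fintype.card, Finset.card_eq_sum_ones]
  simp only [degCount_eq_sum, ← Finset.sum_add_distrib]
  refine Finset.sum_congr rfl fun v _ => ?_
  have := h v
  interval_cases nDeg H v <;> rfl

open scoped Classical in
theorem nDeg_eq_card_filter (H : SimpleGraph V) (v : V) :
    nDeg H v = (Finset.univ.filter (H.Adj v)).card := by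
  rw [nDeg, Set.ncard_eq_toFinset_card']
  congr 1
  ext
  simp

open scoped Classical in
theorem two_mul_sum_nDeg_le_of_independent (S : Finset V)
    (hS : ∀ x ∈ S, ∀ y ∈ S, ¬ H.Adj x y) : 2 * ∑ v ∈ S, nDeg H v ≤ ∑ v, nDeg H v := by
  have hle : ∑ v ∈ S, nDeg H v ≤ ∑ v ∈ Sᶜ, nDeg H v := by
    calc ∑ v ∈ S, nDeg H v ≤ ∑ v ∈ S, (Sᶜ.bipartiteAbove H.Adj v).card := by
          refine Finset.sum_le_sum fun v hv => ?_
          rw [nDeg_eq_card_filter]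
          refine Finset.card_le_card fun x hx => ?_
          simp only [Finset.mem_filter, Finset.mem_univ, true_and] at hx
          simp only [Finset.mem_bipartiteAbove, Finset.mem_compl]
          exact ⟨fun h => hS v hv x h hx, hx⟩
      _ = ∑ v ∈ Sᶜ, (S.bipartiteBelow H.Adj v).card :=
          Finset.sum_card_bipartiteAbove_eq_sum_card_bipartiteBelow _
      _ ≤ ∑ v ∈ Sᶜ, nDeg H v := by
          refine Finset.sum_le_sum fun v _ => ?_
          rw [nDeg_eq_card_filter]
          refine Finset.card_le_card fun x hx => ?_
          simpa using ((Finset.mem_bipartiteBelow _).1 hx).2.symm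
  have := Finset.sum_add_sum_compl S (nDeg H)
  omega

/-- If the vertices of degree `3` are too many to be independent, two of them are adjacent. -/
theorem exists_adj_degree_three {t : ℕ} (hsum : ∑ v, nDeg H v = 6 * t) (h3 : t < degCount H 3) :
    ∃ a b, H.Adj a b ∧ nDeg H a = 3 ∧ nDeg H b = 3 := by
  classical
  by_contra! hcon
  have hind := two_mul_sum_nDeg_le_of_independent (H := H)
    (Finset.univ.filter fun v => nDeg H v = 3) fun x hx y hy hxy =>
      hcon x y hxy (by simpa using hx) (by simpa using hy)
  have hS : ∑ v ∈ Finset.univ.filter (fun v => nDeg H v = 3), nDeg H v = 3 * degCount H 3 := by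
    rw [Finset.sum_congr rfl (g := fun _ => 3) (by simp), degCount_eq_sum]
    simp [mul_comm]
  omega

theorem degCount_sdiff {j k : ℕ} (hH : H ≤ G) (hG : ∀ v, nDeg G v = j + k) :
    degCount (G \ H) j = degCount H k := by
  rw [degCount, degCount]
  congr 1
  ext v
  have := nDeg_sdiff hH v
  have := hG v
  simp only [Set.mem_ofPred_eq]
  omega

theorem exists_of_degCount_pos {k : ℕ} (h : 0 < degCount H k) : ∃ v, nDeg H v = k :=
  (Set.ncard_pos (Set.toFinite _)).1 h

theorem exists_adj_of_nDeg_pos {v : V} (h : 0 < nDeg H v) : ∃ x, H.Adj v x :=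
  (Set.ncard_pos (Set.toFinite _)).1 h

theorem eq_of_adj_of_nDeg_one {v x y : V} (h : nDeg H v = 1) (hx : H.Adj v x) (hy : H.Adj v y) :
    x = y :=
  (Set.ncard_le_one_iff (Set.toFinite _)).1 h.le hx hy

theorem nDeg_pos_of_adj {x y : V} (h : H.Adj x y) : 0 < nDeg H x :=
  (Set.ncard_pos (Set.toFinite _)).2 ⟨y, h⟩

theorem adj_of_nDeg_eq {x y : V} (hH : H ≤ G) (h : nDeg H x = nDeg G x) (hxy : G.Adj x y) :
    H.Adj x y := by
  have := nDeg_sdiff hH x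
  by_contra hn
  have := nDeg_pos_of_adj (H := G \ H) (x := x) (y := y) ⟨hxy, hn⟩
  omega


theorem exists_edge_rotation_swap (hH : H ≤ G) {u v w l y m m' : V} (huv : H.Adj u v)
    (hvw : G.Adj v w) (hvw' : ¬ H.Adj v w) (hly : H.Adj l y) (hmm : G.Adj m m')
    (hmm' : ¬ H.Adj m m') (hT : [u, v, w, l, y, m, m'].Nodup) :
    ∃ H' ≤ G, ∀ k,
      degCount H' k + [nDeg H u, nDeg H w, nDeg H l, nDeg H y, nDeg H m, nDeg H m'].count k =
        degCount H k + [nDeg H u - 1, nDeg H w + 1, nDeg H l - 1, nDeg H y - 1, nDeg H m + 1,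
          nDeg H m' + 1].count k := by
  classical
  have hu := nDeg_pos_of_adj huv
  have hl := nDeg_pos_of_adj hly
  have hy := nDeg_pos_of_adj hly.symm
  simp only [List.nodup_cons, List.mem_cons, List.not_mem_nil, or_false, not_or, not_false_eq_true,
    List.nodup_nil, and_true] at hT
  refine exists_edge_exchange_two hH huv hly ?_ hvw hvw' hmm hmm' ?_
    [(u, nDeg H u, nDeg H u - 1), (w, nDeg H w, nDeg H w + 1), (l, nDeg H l, nDeg H l - 1),
      (y, nDeg H y, nDeg H y - 1), (m, nDeg H m, nDeg H m + 1), (m', nDeg H m', nDeg H m' + 1)]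
    ?_ ?_ ?_ <;> clear hH huv hvw hvw' hly hmm hmm'
  · grind
  · grind
  · simp [hT]
  · simp
    grind
  · simp
    grind

theorem exists_two_edge_fan_exchange (hH : H ≤ G) {a a' u x w b c : V} (haa : H.Adj a a')
    (hux : H.Adj u x) (hwb : G.Adj w b) (hwb' : ¬ H.Adj w b) (hwc : G.Adj w c)
    (hwc' : ¬ H.Adj w c) (hT : [a, a', u, x, w, b, c].Nodup) :
    ∃ H' ≤ G, ∀ k,
      degCount H' k +
          [nDeg H a, nDeg H a', nDeg H u, nDeg H x, nDeg H w, nDeg H b, nDeg H c].count k =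
        degCount H k + [nDeg H a - 1, nDeg H a' - 1, nDeg H u - 1, nDeg H x - 1, nDeg H w + 2,
          nDeg H b + 1, nDeg H c + 1].count k := by
  classical
  have ha := nDeg_pos_of_adj haa
  have ha' := nDeg_pos_of_adj haa.symm
  have hu := nDeg_pos_of_adj hux
  have hx := nDeg_pos_of_adj hux.symm
  simp only [List.nodup_cons, List.mem_cons, List.not_mem_nil, or_false, not_or, not_false_eq_true,
    List.nodup_nil, and_true] at hT
  refine exists_edge_exchange_two hH haa hux ?_ hwb hwb' hwc hwc' ?_
    [(a, nDeg H a, nDeg H a - 1), (a', nDeg H a', nDeg H a' - 1), (u, nDeg H u, nDeg H u - 1),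
      (x, nDeg H x, nDeg H x - 1), (w, nDeg H w, nDeg H w + 2), (b, nDeg H b, nDeg H b + 1),
      (c, nDeg H c, nDeg H c + 1)]
    ?_ ?_ ?_ <;> clear hH haa hux hwb hwb' hwc hwc'
  · grind
  · grind
  · simp [hT]
  · simp
    grind
  · simp
    grind

theorem exists_rotation_fan_exchange (hH : H ≤ G) {a a' u x w b : V} (haa : H.Adj a a')
    (hux : H.Adj u x) (hwa : G.Adj w a) (hwa' : ¬ H.Adj w a) (hwb : G.Adj w b)
    (hwb' : ¬ H.Adj w b) (hT : [a, a', u, x, w, b].Nodup) :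
    ∃ H' ≤ G, ∀ k,
      degCount H' k + [nDeg H a', nDeg H u, nDeg H x, nDeg H w, nDeg H b].count k =
        degCount H k + [nDeg H a' - 1, nDeg H u - 1, nDeg H x - 1, nDeg H w + 2,
          nDeg H b + 1].count k := by
  classical
  have ha' := nDeg_pos_of_adj haa.symm
  have hu := nDeg_pos_of_adj hux
  have hx := nDeg_pos_of_adj hux.symm
  simp only [List.nodup_cons, List.mem_cons, List.not_mem_nil, or_false, not_or, not_false_eq_true,
    List.nodup_nil, and_true] at hT
  refine exists_edge_exchange_two hH haa hux ?_ hwa hwa' hwb hwb' ?_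
    [(a', nDeg H a', nDeg H a' - 1), (u, nDeg H u, nDeg H u - 1),
      (x, nDeg H x, nDeg H x - 1), (w, nDeg H w, nDeg H w + 2), (b, nDeg H b, nDeg H b + 1)]
    ?_ ?_ ?_ <;> clear hH haa hux hwa hwa' hwb hwb'
  · grind
  · grind
  · simp [hT]
  · simp
    grind
  · simp
    grind
theorem IsOptimal.not_swap {t : ℕ} (hopt : IsOptimal G t H) {a b c d : V} (hab : H.Adj a b)
    (hcd : G.Adj c d) (hn : ¬ H.Adj c d) (hT : [a, b, c, d].Nodup) {i j p q : ℕ}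
    (ha : nDeg H a = i) (hb : nDeg H b = j) (hc : nDeg H c = p) (hd : nDeg H d = q)
    (hhalf : [i, j, p, q].count 1 + 2 * [i, j, p, q].count 2 + 3 * [i, j, p, q].count 3 =
      [i - 1, j - 1, p + 1, q + 1].count 1 + 2 * [i - 1, j - 1, p + 1, q + 1].count 2 +
        3 * [i - 1, j - 1, p + 1, q + 1].count 3)
    (hlt : [i - 1, j - 1, p + 1, q + 1].count 0 + [i - 1, j - 1, p + 1, q + 1].count 3 <
      [i, j, p, q].count 0 + [i, j, p, q].count 3)
    (h0 : t + [i, j, p, q].count 0 ≤ degCount H 0 + [i - 1, j - 1, p + 1, q + 1].count 0)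
    (h3 : t + [i, j, p, q].count 3 ≤ degCount H 3 + [i - 1, j - 1, p + 1, q + 1].count 3) :
    False := by
  subst ha hb hc hd
  exact hopt.false_of_exchange (exists_edge_swap hopt.le hab hcd hn hT) hhalf hlt h0 h3

theorem IsOptimal.exists_adj_three_three {t : ℕ} (hopt : IsOptimal G t H)
    (hcub : ∀ v, nDeg G v = 3) (h3 : t < degCount H 3) :
    ∃ a b, H.Adj a b ∧ nDeg H a = 3 ∧ nDeg H b = 3 := by
  refine exists_adj_degree_three (t := t) ?_ h3
  rw [sum_nDeg_eq fun v => (nDeg_mono hopt.le v).trans (hcub v).le, hopt.half]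

theorem IsOptimal.exists_nonadj_zero_zero {t : ℕ} (hopt : IsOptimal G t H)
    (hcub : ∀ v, nDeg G v = 3) (hcard : Fintype.card V = 4 * t) (h0 : t < degCount H 0) :
    ∃ a b, G.Adj a b ∧ ¬ H.Adj a b ∧ nDeg H a = 0 ∧ nDeg H b = 0 := by
  have hsum : ∑ v, nDeg (G \ H) v = 6 * t := by
    have h := sum_nDeg_eq fun v => (nDeg_mono hopt.le v).trans (hcub v).le
    rw [hopt.half] at h
    have h' : ∑ v, nDeg (G \ H) v + ∑ v, nDeg H v = 3 * (4 * t) := by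
      rw [← Finset.sum_add_distrib, Finset.sum_congr rfl fun v _ => nDeg_sdiff hopt.le v]
      simp [hcub, hcard, mul_comm]
    omega
  obtain ⟨a, b, hab, ha, hb⟩ := exists_adj_degree_three hsum
    (by rwa [degCount_sdiff (k := 0) hopt.le hcub])
  have := nDeg_sdiff hopt.le a
  have := nDeg_sdiff hopt.le b
  have := hcub a
  have := hcub b
  exact ⟨a, b, hab.1, hab.2, by omega, by omega⟩

theorem IsOptimal.exists_adj_three {t : ℕ} (hopt : IsOptimal G t H)
    (hcub : ∀ v, nDeg G v = 3) (hconn : G.Connected) (h3 : 0 < degCount H 3) {b : V}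
    (hb : nDeg H b ≠ 3) :
    ∃ x y, H.Adj x y ∧ nDeg H x = 3 ∧ (nDeg H y = 1 ∨ nDeg H y = 2) := by
  obtain ⟨a, ha⟩ := exists_of_degCount_pos h3
  obtain ⟨x, hx, y, hy, hxy⟩ := exists_adj_mem_notMem hconn {v | nDeg H v = 3} ha hb
  have hH := adj_of_nDeg_eq hopt.le (hx.trans (hcub x).symm) hxy
  refine ⟨x, y, hH, hx, ?_⟩
  have := nDeg_pos_of_adj hH.symm
  have := (nDeg_mono hopt.le y).trans (hcub y).le
  have : nDeg H y ≠ 3 := hy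
  omega

theorem IsOptimal.exists_nonadj_zero {t : ℕ} (hopt : IsOptimal G t H)
    (hcub : ∀ v, nDeg G v = 3) (hconn : G.Connected) (h0 : 0 < degCount H 0) {b : V}
    (hb : nDeg H b ≠ 0) :
    ∃ x y, G.Adj x y ∧ ¬ H.Adj x y ∧ nDeg H x = 0 ∧ (nDeg H y = 1 ∨ nDeg H y = 2) := by
  obtain ⟨a, ha⟩ := exists_of_degCount_pos h0
  obtain ⟨x, hx, y, hy, hxy⟩ := exists_adj_mem_notMem hconn {v | nDeg H v = 0} ha hb
  have hx : nDeg H x = 0 := hx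
  have hy : nDeg H y ≠ 0 := hy
  have hH : ¬ H.Adj x y := fun h => (nDeg_pos_of_adj h).ne' hx
  refine ⟨x, y, hxy, hH, hx, ?_⟩
  have := (nDeg_mono hopt.le y).trans (hcub y).le
  have : nDeg H y ≠ 3 := fun h => hH (adj_of_nDeg_eq hopt.le (h.trans (hcub y).symm) hxy.symm).symm
  omega

theorem IsOptimal.not_lt_and_lt {t : ℕ} (hopt : IsOptimal G t H)
    (hcub : ∀ v, nDeg G v = 3) (hconn : G.Connected) (hcard : Fintype.card V = 4 * t)
    (h0 : t < degCount H 0) (h3 : t < degCount H 3) : False := by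
  obtain ⟨a, b, hab, ha, hb⟩ := hopt.exists_adj_three_three hcub h3
  obtain ⟨p, q, hpq, hpq', hp, hq⟩ := hopt.exists_nonadj_zero_zero hcub hcard h0
  obtain ⟨x, y, hxy, hx, hy⟩ := hopt.exists_adj_three hcub hconn (by omega) (b := p) (by omega)
  obtain ⟨z, w, hzw, hzw', hz, hw⟩ := hopt.exists_nonadj_zero hcub hconn (by omega) (b := a)
    (by omega)
  have := hab.ne
  have := hpq.ne
  rcases hy with hy | hy
  · exact hopt.not_swap hxy hpq hpq' (by grind) hx hy hp hq (by decide) (by decide)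
      (by simp; omega) (by simp; omega)
  rcases hw with hw | hw
  · exact hopt.not_swap hxy hzw hzw' (by grind) hx hy hz hw (by decide) (by decide)
      (by simp; omega) (by simp; omega)
  · exact hopt.not_swap hab hzw hzw' (by grind) ha hb hz hw (by decide) (by decide)
      (by simp; omega) (by simp; omega)

theorem exists_two_nonadj {v : V} (hH : H ≤ G) (hG : nDeg G v = 3) (hv : nDeg H v = 1) :
    ∃ x y, x ≠ y ∧ (G.Adj v x ∧ ¬ H.Adj v x) ∧ (G.Adj v y ∧ ¬ H.Adj v y) := by
  have := nDeg_sdiff hH v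
  exact exists_two_adj (H := G \ H) (v := v) (by omega)

theorem IsOptimal.nDeg_ne_two_of_nonadj {t : ℕ} (hopt : IsOptimal G t H)
    (hcub : ∀ v, nDeg G v = 3) (h3 : t < degCount H 3) {l z : V} (hlz : G.Adj l z)
    (hn : ¬ H.Adj l z) (hl : nDeg H l = 1) : nDeg H z ≠ 2 := by
  intro hz
  obtain ⟨a, b, hab, ha, hb⟩ := hopt.exists_adj_three_three hcub h3
  have := hab.ne
  have := hopt.zero
  exact hopt.not_swap hab hlz hn (by grind) ha hb hl hz (by decide) (by decide)
    (by simp; omega) (by simp; omega)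

theorem IsOptimal.nDeg_eq_zero_or_one_of_nonadj {t : ℕ} (hopt : IsOptimal G t H)
    (hcub : ∀ v, nDeg G v = 3) (h3 : t < degCount H 3) {l z : V} (hlz : G.Adj l z)
    (hn : ¬ H.Adj l z) (hl : nDeg H l = 1) : nDeg H z = 0 ∨ nDeg H z = 1 := by
  have := hopt.nDeg_ne_two_of_nonadj hcub h3 hlz hn hl
  have := (nDeg_mono hopt.le z).trans (hcub z).le
  have : nDeg H z ≠ 3 := fun h =>
    hn (adj_of_nDeg_eq hopt.le (h.trans (hcub z).symm) hlz.symm).symm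
  omega

theorem IsOptimal.not_adj_three_one {t : ℕ} (hopt : IsOptimal G t H)
    (hcub : ∀ v, nDeg G v = 3) (hconn : G.Connected) (h3 : t < degCount H 3)
    (h1 : 1 < degCount H 1) {u v : V} (huv : H.Adj u v) (hu : nDeg H u = 3) :
    nDeg H v ≠ 1 := by
  classical
  intro hv
  have h0 := hopt.zero
  have hv0 : ∀ z, G.Adj v z → ¬ H.Adj v z → nDeg H z = 0 := by
    intro z hvz hn
    rcases hopt.nDeg_eq_zero_or_one_of_nonadj hcub h3 hvz hn hv with hz | hz
    · exact hz
    have hex := exists_edge_rotation hopt.le huv hvz hn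
    rw [hu, hz] at hex
    exact (hopt.false_of_exchange hex (by decide) (by decide)
      (by simp; omega) (by simp; omega)).elim
  obtain ⟨w, -, -, ⟨hvw, hvw'⟩, -⟩ := exists_two_nonadj hopt.le (hcub v) hv
  have hw := hv0 w hvw hvw'
  have hleaf : ∀ l, l ≠ v → nDeg H l = 1 → ∀ z, G.Adj l z → ¬ H.Adj l z →
      z ≠ v ∧ nDeg H z = 1 := by
    intro l hlv hl z hlz hn
    have hzv : z ≠ v := by
      rintro rfl
      have := hv0 l hlz.symm fun h => hn h.symm
      omega
    refine ⟨hzv, (hopt.nDeg_eq_zero_or_one_of_nonadj hcub h3 hlz hn hl).resolve_left fun hz => ?_⟩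
    exact hopt.not_swap huv hlz hn (by grind) hu hv hl hz (by decide) (by decide)
      (by simp; omega) (by simp; omega)
  obtain ⟨l₀, hl₀v, hl₀⟩ := exists_ne_of_one_lt_degCount h1 v
  obtain ⟨l, ⟨hlv, hl⟩, y, hy, hly⟩ := exists_adj_mem_notMem hconn {x | x ≠ v ∧ nDeg H x = 1}
    (a := l₀) (b := v) ⟨hl₀v, hl₀⟩ (fun h => h.1 rfl)
  have hyH : H.Adj l y := by
    by_contra hn
    exact hy (hleaf l hlv hl y hly hn)
  have hy2 : nDeg H y = 2 := by
    have := nDeg_pos_of_adj hyH.symm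
    have := (nDeg_mono hopt.le y).trans (hcub y).le
    have hy1 : nDeg H y ≠ 1 := by
      intro hy1
      refine hy ⟨?_, hy1⟩
      rintro rfl
      have := eq_of_adj_of_nDeg_one hv huv.symm hyH.symm
      subst this
      omega
    have hy3 : nDeg H y ≠ 3 := fun hy3 =>
      hopt.not_swap hyH.symm hvw hvw' (by grind) hy3 hl hv hw (by decide) (by decide)
        (by simp; omega) (by simp; omega)
    omega
  obtain ⟨m, -, -, ⟨hlm, hlm'⟩, -⟩ := exists_two_nonadj hopt.le (hcub l) hl
  obtain ⟨hmv, hm⟩ := hleaf l hlv hl m hlm hlm'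
  obtain ⟨m', hmm, hmm', hm'l⟩ : ∃ m', G.Adj m m' ∧ ¬ H.Adj m m' ∧ m' ≠ l := by
    obtain ⟨p, q, hpq, ⟨hp, hp'⟩, hq, hq'⟩ := exists_two_nonadj hopt.le (hcub m) hm
    by_cases hpl : p = l
    · exact ⟨q, hq, hq', fun h => hpq (hpl.trans h.symm)⟩
    · exact ⟨p, hp, hp', hpl⟩
  obtain ⟨hm'v, hm'⟩ := hleaf m hmv hm m' hmm hmm'
  have hex := exists_edge_rotation_swap hopt.le huv hvw hvw' hyH hmm hmm' (by
    have := hlm.ne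
    have := hmm.ne
    clear hleaf hv0 hcub hconn hopt
    simp only [List.nodup_cons, List.mem_cons, List.not_mem_nil, or_false, not_or,
      not_false_eq_true, List.nodup_nil, and_true]
    and_intros <;> grind)
  rw [hu, hw, hl, hy2, hm, hm'] at hex
  exact hopt.false_of_exchange hex (by decide) (by decide) (by simp; omega) (by simp; omega)

theorem exists_nDeg_zero_three_adj (h01 : degCount H 0 < degCount H 1) (hH : H ≤ G)
    (hcub : ∀ v, nDeg G v = 3)
    (hz : ∀ l z, nDeg H l = 1 → G.Adj l z → ¬ H.Adj l z → nDeg H z = 0) :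
    ∃ w a b c, nDeg H w = 0 ∧ a ≠ b ∧ a ≠ c ∧ b ≠ c ∧
      (G.Adj w a ∧ nDeg H a = 1) ∧ (G.Adj w b ∧ nDeg H b = 1) ∧ (G.Adj w c ∧ nDeg H c = 1) := by
  classical
  let S := Finset.univ.filter fun v => nDeg H v = 1
  let Z := Finset.univ.filter fun v => nDeg H v = 0
  by_contra! hcon
  have hle : S.card * 2 ≤ Z.card * 2 := by
    refine Finset.card_mul_le_card_mul (G \ H).Adj (fun l hl => ?_) fun w hw => ?_
    · have hl : nDeg H l = 1 := by simpa [S] using hl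
      have h2 : nDeg (G \ H) l = 2 := by
        have := nDeg_sdiff hH l
        have := hcub l
        omega
      rw [← h2, nDeg_eq_card_filter]
      refine Finset.card_le_card fun z hz' => ?_
      have hz' : (G \ H).Adj l z := by simpa using hz'
      rw [Finset.mem_bipartiteAbove]
      exact ⟨by simpa [Z] using hz l z hl hz'.1 hz'.2, hz'⟩
    · have hw : nDeg H w = 0 := by simpa [Z] using hw
      by_contra! h2
      obtain ⟨a, b, c, ha, hb, hc, hab, hac, hbc⟩ := Finset.two_lt_card_iff.1 h2
      simp only [Finset.mem_bipartiteBelow, S, Finset.mem_filter, Finset.mem_univ,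
        true_and] at ha hb hc
      exact hcon w a b c hw hab hac hbc ⟨ha.2.1.symm, ha.1⟩ ⟨hb.2.1.symm, hb.1⟩ hc.2.1.symm hc.1
  have hS : S.card = degCount H 1 := by simp [degCount_eq_sum, S]
  have hZ : Z.card = degCount H 0 := by simp [degCount_eq_sum, Z]
  omega

theorem IsOptimal.degCount_three_le {t : ℕ} (hopt : IsOptimal G t H)
    (hcub : ∀ v, nDeg G v = 3) (hconn : G.Connected) (hcard : Fintype.card V = 4 * t) :
    degCount H 3 ≤ t := by
  by_contra! h3
  have h0 : degCount H 0 = t := by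
    by_contra h
    have := hopt.zero
    exact hopt.not_lt_and_lt hcub hconn hcard (by omega) h3
  have htot := sum_degCount_eq fun v => (nDeg_mono hopt.le v).trans (hcub v).le
  have hhalf := hopt.half
  have ht : 0 < t := by
    have := hconn.nonempty
    have := Fintype.card_pos (α := V)
    omega
  obtain ⟨z, hz⟩ := exists_of_degCount_pos (H := H) (k := 0) (by omega)
  have h31 {u v : V} : H.Adj u v → nDeg H u = 3 → nDeg H v ≠ 1 :=
    hopt.not_adj_three_one hcub hconn h3 (by omega)
  obtain ⟨u, x, hux, hu, hx | hx⟩ := hopt.exists_adj_three hcub hconn (by omega) (b := z) (by omega)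
  · exact h31 hux hu hx
  have hleaf : ∀ l z, nDeg H l = 1 → G.Adj l z → ¬ H.Adj l z → nDeg H z = 0 := by
    intro l z hl hlz hn
    refine (hopt.nDeg_eq_zero_or_one_of_nonadj hcub h3 hlz hn hl).resolve_right fun hz => ?_
    have := hlz.ne
    exact hopt.not_swap hux hlz hn (by grind) hu hx hl hz (by decide) (by decide)
      (by simp; omega) (by simp; omega)
  obtain ⟨w, a, b, c, hw, hab, hac, hbc, ⟨hwa, ha⟩, ⟨hwb, hb⟩, hwc, hc⟩ :=
    exists_nDeg_zero_three_adj (by omega) hopt.le hcub hleaf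
  have hw' : ∀ y, ¬ H.Adj w y := fun y h => (nDeg_pos_of_adj h).ne' hw
  have key : ∀ a b c, a ≠ b → a ≠ c → b ≠ c → G.Adj w a → nDeg H a = 1 → G.Adj w b →
      nDeg H b = 1 → G.Adj w c → nDeg H c = 1 → H.Adj x a := by
    intro a b c hab hac hbc hwa ha hwb hb hwc hc
    by_contra hxa
    obtain ⟨a', haa⟩ := exists_adj_of_nDeg_pos (H := H) (v := a) (by omega)
    have ha'x : a' ≠ x := by
      rintro rfl
      exact hxa haa.symm
    have ha'a := haa.ne'
    have ha'3 : nDeg H a' ≠ 3 := fun h => h31 haa.symm h ha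
    have ha'le := (nDeg_mono hopt.le a').trans (hcub a').le
    have ha'pos := nDeg_pos_of_adj haa.symm
    obtain ha' | ha' : nDeg H a' = 1 ∨ nDeg H a' = 2 := by omega
    · obtain ⟨d, had, ha'd, hwd, hd⟩ :
          ∃ d, a ≠ d ∧ a' ≠ d ∧ G.Adj w d ∧ nDeg H d = 1 := by
        by_cases h : a' = b
        · exact ⟨c, hac, fun h' => hbc (h.symm.trans h'), hwc, hc⟩
        · exact ⟨b, hab, h, hwb, hb⟩
      have hex := exists_rotation_fan_exchange hopt.le haa hux hwa (hw' a) hwd (hw' d) (by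
        clear hleaf hcub hconn hopt h31 hw'
        simp only [List.nodup_cons, List.mem_cons, List.not_mem_nil, or_false, not_or,
          not_false_eq_true, List.nodup_nil, and_true]
        and_intros <;> grind)
      rw [ha', hu, hx, hw, hd] at hex
      exact hopt.false_of_exchange hex (by decide) (by decide) (by simp; omega) (by simp; omega)
    · have hex := exists_two_edge_fan_exchange hopt.le haa hux hwb (hw' b) hwc (hw' c) (by
        clear hleaf hcub hconn hopt h31 hw'
        simp only [List.nodup_cons, List.mem_cons, List.not_mem_nil, or_false, not_or,
          not_false_eq_true, List.nodup_nil, and_true]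
        and_intros <;> grind)
      rw [ha, ha', hu, hx, hw, hb, hc] at hex
      exact hopt.false_of_exchange hex (by decide) (by decide) (by simp; omega) (by simp; omega)
  have hxa := key a b c hab hac hbc hwa ha hwb hb hwc hc
  have hxb := key b a c hab.symm hbc hac hwb hb hwa ha hwc hc
  have : 2 < nDeg H x := (Set.two_lt_ncard_iff (Set.toFinite _)).2
    ⟨u, a, b, hux.symm, hxa, hxb, by grind, by grind, hab⟩
  omega

theorem IsAdmissible.sdiff {t : ℕ} (h : IsAdmissible G t H) (hcub : ∀ v, nDeg G v = 3)
    (hcard : Fintype.card V = 4 * t) : IsAdmissible G t (G \ H) where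
  le := sdiff_le
  zero := by simpa [degCount_sdiff (j := 0) (k := 3) h.le hcub] using h.three
  three := by simpa [degCount_sdiff (j := 3) (k := 0) h.le hcub] using h.zero
  half := by
    have h1 := degCount_sdiff (j := 1) (k := 2) h.le hcub
    have h2 := degCount_sdiff (j := 2) (k := 1) h.le hcub
    have h3 := degCount_sdiff (j := 3) (k := 0) h.le hcub
    have htot := sum_degCount_eq fun v => (nDeg_mono h.le v).trans (hcub v).le
    have := h.half
    omega

theorem IsOptimal.sdiff {t : ℕ} (h : IsOptimal G t H) (hcub : ∀ v, nDeg G v = 3)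
    (hcard : Fintype.card V = 4 * t) : IsOptimal G t (G \ H) where
  toIsAdmissible := h.toIsAdmissible.sdiff hcub hcard
  min K hK := by
    have := h.min K hK
    have h0 := degCount_sdiff (j := 0) (k := 3) h.le hcub
    have h3 := degCount_sdiff (j := 3) (k := 0) h.le hcub
    omega

theorem IsOptimal.degCount_eq {t : ℕ} (h : IsOptimal G t H) (hcub : ∀ v, nDeg G v = 3)
    (hconn : G.Connected) (hcard : Fintype.card V = 4 * t) {k : ℕ} (hk : k ≤ 3) :
    degCount H k = t := by
  have h3 := h.degCount_three_le hcub hconn hcard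
  have h0 := (h.sdiff hcub hcard).degCount_three_le hcub hconn hcard
  rw [degCount_sdiff (j := 3) (k := 0) h.le hcub] at h0
  have htot := sum_degCount_eq fun v => (nDeg_mono h.le v).trans (hcub v).le
  have hz := h.zero
  have ht := h.three
  have := h.half
  interval_cases k <;> omega

open scoped Classical in
/-- Growing a set of vertices along edges of a connected cubic graph, each new vertex adds at most
two vertices to the closed neighborhood. -/
theorem exists_card_eq_card_closedNbhd_le (hconn : G.Connected) (hcub : ∀ v, nDeg G v = 3) {k : ℕ}
    (hk : k + 1 ≤ Fintype.card V) :
    ∃ A : Finset V, A.card = k + 1 ∧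
      (A ∪ A.biUnion fun v => Finset.univ.filter (G.Adj v)).card ≤ 2 * (k + 1) + 2 := by
  induction k with
  | zero =>
    obtain ⟨v⟩ := hconn.nonempty
    refine ⟨{v}, by simp, (Finset.card_union_le _ _).trans ?_⟩
    rw [Finset.singleton_biUnion, ← nDeg_eq_card_filter, hcub]
    simp
  | succ k ih =>
    obtain ⟨A, hA, hN⟩ := ih (by omega)
    obtain ⟨a, ha⟩ : A.Nonempty := Finset.card_pos.1 (by omega)
    obtain ⟨b, hb⟩ : ∃ b, b ∉ A := by
      by_contra! h
      have := Finset.eq_univ_of_forall h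
      rw [this, Finset.card_univ] at hA
      omega
    obtain ⟨x, hx, y, hy, hxy⟩ := exists_adj_mem_notMem hconn (A : Set V) (a := a) (b := b)
      (by simpa using ha) (by simpa using hb)
    simp only [Finset.mem_coe] at hx hy
    refine ⟨insert y A, by rw [Finset.card_insert_of_notMem hy, hA], ?_⟩
    set N := A ∪ A.biUnion fun v => Finset.univ.filter (G.Adj v) with hNdef
    have hsub : (insert y A ∪ (insert y A).biUnion fun v => Finset.univ.filter (G.Adj v)) ⊆
        N ∪ (Finset.univ.filter (G.Adj y)).erase x := by
      intro z hz
      simp only [hNdef, Finset.mem_union, Finset.mem_insert, Finset.mem_biUnion, Finset.mem_filter,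
        Finset.mem_univ, true_and, Finset.mem_erase] at hz ⊢
      grind
    have hcard : ((Finset.univ.filter (G.Adj y)).erase x).card = 2 := by
      rw [Finset.card_erase_of_mem (by simpa using hxy.symm), ← nDeg_eq_card_filter, hcub]
    have := (Finset.card_le_card hsub).trans (Finset.card_union_le _ _)
    omega

theorem exists_isAdmissible {t : ℕ} (ht : 2 ≤ t) (hcard : Fintype.card V = 4 * t)
    (hconn : G.Connected) (hcub : ∀ v, nDeg G v = 3) : ∃ H, IsAdmissible G t H := by
  classical
  obtain ⟨A, hA, hN⟩ := exists_card_eq_card_closedNbhd_le hconn hcub (k := t - 1) (by omega)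
  set N := A ∪ A.biUnion fun v => Finset.univ.filter (G.Adj v) with hNdef
  obtain ⟨B, hBN, hB⟩ := Finset.exists_subset_card_eq (s := Nᶜ) (n := t) (by
    rw [Finset.card_compl]
    omega)
  have hdeg (v : V) : G.degree v = 3 := by rw [← nDeg_eq_degree, hcub]
  let I (v : V) := G.incidenceFinset v
  have hinc (S : Finset V) (hS : S.card = t) : (S.biUnion I).card ≤ 3 * t := by
    refine Finset.card_biUnion_le.trans ?_
    simp [I, hdeg, hS, mul_comm]
  have hE : G.edgeFinset.card = 6 * t := by
    have := G.sum_degrees_eq_twice_card_edges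
    simp only [hdeg, Finset.sum_const, Finset.card_univ, hcard, smul_eq_mul] at this
    omega
  have hincA := hinc A (by omega)
  have hincB := hinc B hB
  have hsub : A.biUnion I ⊆ G.edgeFinset \ B.biUnion I := by
    intro e he
    simp only [Finset.mem_biUnion, I, mem_incidenceFinset] at he
    obtain ⟨a, ha, hae⟩ := he
    simp only [Finset.mem_sdiff, Finset.mem_biUnion, I, mem_incidenceFinset, mem_edgeFinset]
    refine ⟨hae.1, ?_⟩
    rintro ⟨b, hb, hbe⟩
    have hbN := hBN hb
    simp only [hNdef, Finset.compl_union, Finset.mem_inter, Finset.mem_compl, Finset.mem_biUnion,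
      Finset.mem_filter, Finset.mem_univ, true_and, not_exists, not_and] at hbN
    have hab : a ≠ b := by
      rintro rfl
      exact hbN.1 ha
    exact hbN.2 a ha (G.adj_of_mem_incidenceSet hab hae hbe)
  obtain ⟨F, hAF, hFB, hF⟩ := Finset.exists_subsuperset_card_eq (n := 3 * t) hsub hincA (by
    have := Finset.le_card_sdiff (B.biUnion I) G.edgeFinset
    omega)
  have hFE : ∀ e ∈ F, e ∈ G.edgeSet := fun e he =>
    mem_edgeFinset.1 (Finset.mem_sdiff.1 (hFB he)).1
  have hle : fromEdgeSet (F : Set (Sym2 V)) ≤ G := by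
    intro x y hxy
    exact hFE _ (by simpa using hxy.1)
  have hle3 := fun v => (nDeg_mono hle v).trans (hcub v).le
  refine ⟨fromEdgeSet (F : Set (Sym2 V)), hle, ?_, ?_, ?_⟩
  · rw [degCount, ← hB, ← Set.ncard_coe_finset]
    refine Set.ncard_le_ncard (fun b hb => ?_) (Set.toFinite _)
    by_contra h
    obtain ⟨y, hy⟩ := exists_adj_of_nDeg_pos (Nat.pos_of_ne_zero h)
    have hbF : s(b, y) ∈ F := by simpa using hy.1
    refine (Finset.mem_sdiff.1 (hFB hbF)).2 (Finset.mem_biUnion.2 ⟨b, by simpa using hb, ?_⟩)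
    rw [mem_incidenceFinset]
    exact ⟨hFE _ hbF, by simp⟩
  · rw [degCount, ← show A.card = t by omega, ← Set.ncard_coe_finset]
    refine Set.ncard_le_ncard (fun a ha => ?_) (Set.toFinite _)
    have : (fromEdgeSet (F : Set (Sym2 V))).neighborSet a = G.neighborSet a := by
      ext y
      refine ⟨fun h => hle h, fun h => ?_⟩
      rw [mem_neighborSet, fromEdgeSet_adj]
      refine ⟨hAF (Finset.mem_biUnion.2 ⟨a, by simpa using ha, ?_⟩), G.ne_of_adj h⟩
      rw [mem_incidenceFinset]
      exact ⟨h, by simp⟩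
    show nDeg _ a = 3
    rw [nDeg, this]
    exact hcub a
  · rw [← sum_nDeg_eq hle3]
    simp only [nDeg_eq_degree]
    rw [sum_degrees_eq_twice_card_edges]
    trans 2 * F.card
    · congr 2
      ext e
      simp only [mem_edgeFinset, edgeSet_fromEdgeSet, Set.mem_sdiff, Finset.mem_coe]
      exact ⟨fun h => h.1, fun h => ⟨h, G.not_isDiag_of_mem_edgeSet (hFE e h)⟩⟩
    · omega

theorem nonempty_iso_K4 (hcard : Fintype.card V = 4) (hcub : ∀ v, nDeg G v = 3) :
    Nonempty (G ≃g K4) := by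
  classical
  have htop : G = ⊤ := by
    ext v w
    rw [top_adj]
    refine ⟨fun h => h.ne, fun h => ?_⟩
    by_contra hn
    have hsub : Finset.univ.filter (G.Adj v) ⊆ (Finset.univ.erase v).erase w := by
      intro z hz
      simp only [Finset.mem_filter, Finset.mem_univ, true_and, Finset.mem_erase] at hz ⊢
      grind [G.ne_of_adj hz]
    have hle := Finset.card_le_card hsub
    rw [← nDeg_eq_card_filter, hcub, Finset.card_erase_of_mem (by simp [h.symm]),
      Finset.card_erase_of_mem (by simp), Finset.card_univ, hcard] at hle
    omega
  subst htop
  exact ⟨Iso.completeGraph (Fintype.equivFinOfCardEq hcard)⟩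

end SpanningSubgraphs

theorem stmt7 {V : Type*} [Fintype V] (G : SimpleGraph V) (t : ℕ)
    (hn : Fintype.card V = 4 * t) (hconn : G.Connected)
    (hcubic : ∀ v, nDeg G v = 3) (hK4 : ¬ Nonempty (G ≃g K4)) :
    ∃ H ≤ G, ∀ k ≤ 3, degCount H k = t := by
  have hpos : 0 < t := by
    have := hconn.nonempty
    have := Fintype.card_pos (α := V)
    omega
  have ht : t ≠ 1 := by
    rintro rfl
    exact hK4 (nonempty_iso_K4 hn hcubic)
  obtain ⟨K, hK⟩ := exists_isAdmissible (by omega) hn hconn hcubic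
  obtain ⟨H, hH⟩ := hK.exists_isOptimal
  exact ⟨H, hH.le, fun k hk => hH.degCount_eq hcubic hconn hn hk⟩
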